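/- arXiv:1909.10787 — 4 statements merged into one kernel-verified Lean document; each statement's English description precedes it below -/
import Mathlib

section
/- Let H be a separable real Hilbert space, let (λ_j)_{j≥1} be a nonincreasing summable sequence of positive reals, let (u_j)_{j≥1} be an orthonormal basis of H, and let Σ = Σ_{j≥1} λ_j (u_j ⊗ u_j). Then for every natural number d ≥ 1, the orthogonal projection P_{≤d} = Σ_{j≤d} (u_j ⊗ u_j) minimizes tr(Σ(I − P)) over the class 𝒫_d of all rank-d orthogonal projections P on H, and the minimal value is tr(Σ(I − P_{≤d})) = Σ_{k>d} λ_k. -/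
open scoped RealInnerProductSpace BigOperators

/-- The rank-one operator `u ⊗ v : x ↦ ⟨v, x⟩ u`. -/
noncomputable def rankOne {H : Type*} [NormedAddCommGroup H] [InnerProductSpace ℝ H]
    (u v : H) : H →L[ℝ] H :=
  (innerSL ℝ v).smulRight u

/-- A weighted sum of a nonincreasing sequence, with weights in `[0, 1]` of total mass `d`, leaves
at least the tail of the sequence. -/
lemma tsum_tail_le_tsum_mul_one_sub {μ w : ℕ → ℝ} (hμ : Antitone μ) (hs : Summable μ)
    {d : ℕ} (h0 : ∀ j, 0 ≤ w j) (h1 : ∀ j, w j ≤ 1) (hw : HasSum w d) :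
    ∑' j, μ j * (1 - if j < d then 1 else 0) ≤ ∑' j, μ j * (1 - w j) := by
  have hind : HasSum (fun j => if j < d then (1 : ℝ) else 0) d := by
    have h : ∑ j ∈ Finset.range d, (if j < d then (1 : ℝ) else 0) = d := by
      rw [Finset.sum_congr rfl fun j hj => if_pos (Finset.mem_range.1 hj)]
      simp
    rw [← h]
    exact hasSum_sum_of_ne_finset_zero fun j hj => if_neg (by simpa using hj)
  have hsv : ∀ v : ℕ → ℝ, (∀ j, 0 ≤ v j) → (∀ j, v j ≤ 1) →
      Summable fun j => μ j * (1 - v j) := fun v hv0 hv1 =>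
    hs.norm.of_norm_bounded fun j => by
      rw [norm_mul]
      refine mul_le_of_le_one_right (norm_nonneg _) ?_
      rw [Real.norm_eq_abs, abs_le]
      constructor <;> linarith [hv0 j, hv1 j]
  have hA := hsv (fun j => if j < d then 1 else 0) (fun j => by split_ifs <;> simp)
    (fun j => by split_ifs <;> simp)
  have hzero : HasSum (fun j => μ d * ((if j < d then 1 else 0) - w j)) 0 := by
    simpa using (hind.sub hw).mul_left (μ d)
  have hle := hasSum_le (fun j => ?_) (hA.hasSum.add hzero) (hsv w h0 h1).hasSum
  · simpa using hle
  · by_cases hj : j < d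
    · simp only [hj, if_true]
      nlinarith [mul_nonneg (sub_nonneg.2 (hμ hj.le)) (sub_nonneg.2 (h1 j))]
    · simp only [hj, if_false]
      nlinarith [mul_nonneg (sub_nonneg.2 (hμ (not_lt.1 hj))) (h0 j)]

section HilbertBasis

variable {H : Type*} [NormedAddCommGroup H] [InnerProductSpace ℝ H]

lemma rankOne_apply (u v x : H) : rankOne u v x = ⟪v, x⟫ • u := by
  simp [rankOne]

lemma norm_rankOne_le (u v : H) : ‖rankOne u v‖ ≤ ‖u‖ * ‖v‖ := by
  refine ContinuousLinearMap.opNorm_le_bound _ (by positivity) fun x => ?_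
  rw [rankOne_apply, norm_smul, mul_comm, mul_assoc]
  exact mul_le_mul_of_nonneg_left (norm_inner_le_norm v x) (norm_nonneg u)

lemma Orthonormal.inner_tsum_smul_rankOne_apply [CompleteSpace H] {e : ℕ → H}
    (he : Orthonormal ℝ e) {μ : ℕ → ℝ} (hs : Summable μ) (j : ℕ) (x : H) :
    ⟪e j, (∑' k, μ k • rankOne (e k) (e k)) x⟫ = μ j * ⟪e j, x⟫ := by
  have hsum : Summable fun k => μ k • rankOne (e k) (e k) :=
    hs.norm.of_norm_bounded fun k => by
      rw [norm_smul]
      refine mul_le_of_le_one_right (norm_nonneg _) ((norm_rankOne_le _ _).trans ?_)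
      simp [he.1 k]
  have h := ((innerSL ℝ (e j)).comp (ContinuousLinearMap.apply ℝ H x)).hasSum hsum.hasSum
  refine h.unique ?_
  have hfun : (fun k => ((innerSL ℝ (e j)).comp (ContinuousLinearMap.apply ℝ H x))
      (μ k • rankOne (e k) (e k))) = fun k => if k = j then μ j * ⟪e j, x⟫ else 0 := by
    funext k
    by_cases hk : k = j
    · subst hk
      simp [rankOne_apply, he.1 k]
    · simp [rankOne_apply, he.2 (Ne.symm hk), hk]
  rw [hfun]
  exact hasSum_ite_eq j _

lemma Orthonormal.inner_sum_rankOne_apply_self {e : ℕ → H} (he : Orthonormal ℝ e) (d j : ℕ) :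
    ⟪e j, (∑ l ∈ Finset.range d, rankOne (e l) (e l)) (e j)⟫ = if j < d then 1 else 0 := by
  simp [rankOne_apply, orthonormal_iff_ite.1 he, apply_ite (fun y => ⟪e j, y⟫), he.1 j]

/-- An orthogonal projection satisfies `⟪x, P x⟫ = ‖P x‖ ^ 2`. -/
lemma inner_self_apply_eq_norm_sq [CompleteSpace H] {P : H →L[ℝ] H} (hP : IsSelfAdjoint P)
    (hPi : IsIdempotentElem P) (x : H) : ⟪x, P x⟫ = ‖P x‖ ^ 2 := by
  have hPP : P (P x) = P x := congrArg (fun T : H →L[ℝ] H => T x) hPi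
  rw [← real_inner_self_eq_norm_sq]
  nth_rewrite 1 [← hPP]
  exact (hP.isSymmetric x (P x)).symm

lemma norm_apply_le_of_isSelfAdjoint_of_isIdempotentElem [CompleteSpace H] {P : H →L[ℝ] H}
    (hP : IsSelfAdjoint P) (hPi : IsIdempotentElem P) (x : H) : ‖P x‖ ≤ ‖x‖ := by
  have h := real_inner_le_norm x (P x)
  rw [inner_self_apply_eq_norm_sq hP hPi] at h
  nlinarith [norm_nonneg x, norm_nonneg (P x)]

/-- The trace of a finite-rank orthogonal projection along a Hilbert basis is its rank. -/
lemma HilbertBasis.hasSum_inner_apply_self [CompleteSpace H] {ι : Type*}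
    (b : HilbertBasis ι ℝ H) {P : H →L[ℝ] H} (hP : IsSelfAdjoint P) (hPi : IsIdempotentElem P)
    [FiniteDimensional ℝ (LinearMap.range (P : H →ₗ[ℝ] H))] :
    HasSum (fun j => ⟪b j, P (b j)⟫)
      (Module.finrank ℝ (LinearMap.range (P : H →ₗ[ℝ] H)) : ℝ) := by
  let v := stdOrthonormalBasis ℝ (LinearMap.range (P : H →ₗ[ℝ] H))
  have hPv : ∀ i, P (v i : H) = v i := fun i => by
    obtain ⟨y, hy⟩ := (v i).2
    rw [← hy]
    exact congrArg (fun T : H →L[ℝ] H => T y) hPi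
  have hterm : ∀ j, ⟪b j, P (b j)⟫ = ∑ i, ⟪(v i : H), b j⟫ * ⟪b j, (v i : H)⟫ := fun j => by
    have h := v.sum_sq_norm_inner_right ⟨P (b j), LinearMap.mem_range_self _ (b j)⟩
    rw [inner_self_apply_eq_norm_sq hP hPi]
    refine h.symm.trans (Finset.sum_congr rfl fun i _ => ?_)
    have h2 : ⟪(v i : H), P (b j)⟫ = ⟪(v i : H), b j⟫ := by
      conv_rhs => rw [← hPv i]
      exact (hP.isSymmetric (v i : H) (b j)).symm
    rw [Submodule.coe_inner, h2, real_inner_comm (v i : H) (b j), Real.norm_eq_abs, sq_abs, sq]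
  have hone : ∀ i, ⟪(v i : H), (v i : H)⟫ = 1 := fun i => by
    rw [real_inner_self_eq_norm_sq, Submodule.norm_coe, v.orthonormal.1 i, one_pow]
  have h := hasSum_sum (s := Finset.univ) fun i _ => b.hasSum_inner_mul_inner (v i : H) (v i : H)
  simp only [hone, Finset.sum_const, Finset.card_univ, Fintype.card_fin, nsmul_eq_mul,
    mul_one] at h
  simpa only [hterm] using h

end HilbertBasis

/-- **`P_{≤ d}` minimizes the reconstruction error**: for `Σ = ∑_{j ≥ 1} λ_j (u_j ⊗ u_j)`
with nonincreasing summable positive eigenvalues, the projection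
`P_{≤ d} = ∑_{j ≤ d} (u_j ⊗ u_j)` minimizes `tr(Σ(I - P))` over all rank-`d`
orthogonal projections `P`, and the minimal value is `tr(Σ(I - P_{≤ d})) = ∑_{k > d} λ_k`.
The trace is computed along the orthonormal basis `(u_j)_{j ≥ 1}`. -/
theorem projection_minimizes_reconstruction_error
    (H : Type) [NormedAddCommGroup H] [InnerProductSpace ℝ H] [CompleteSpace H]
    (lam : ℕ → ℝ) (u : ℕ → H) (b : HilbertBasis ℕ ℝ H) (Sig : H →L[ℝ] H)
    -- `(u_j)_{j ≥ 1}` is an orthonormal basis of `H`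
    (hb : ∀ j : ℕ, b j = u (j + 1))
    -- `(λ_j)_{j ≥ 1}` is a nonincreasing summable sequence of positive reals
    (hpos : ∀ j : ℕ, 1 ≤ j → 0 < lam j)
    (hmono : ∀ j : ℕ, 1 ≤ j → lam (j + 1) ≤ lam j)
    (hsum : Summable (fun j : ℕ => lam (j + 1)))
    -- `Σ = ∑_{j ≥ 1} λ_j (u_j ⊗ u_j)`
    (hSig : Sig = ∑' j : ℕ, lam (j + 1) • rankOne (u (j + 1)) (u (j + 1))) :
    ∀ d : ℕ, 1 ≤ d →
      -- the minimal value: `tr(Σ(I - P_{≤ d})) = ∑_{k > d} λ_k`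
      (∑' j : ℕ, ⟪u (j + 1),
          Sig (u (j + 1) - (∑ l ∈ Finset.range d,
            rankOne (u (l + 1)) (u (l + 1))) (u (j + 1)))⟫) =
        (∑' k : ℕ, lam (d + 1 + k)) ∧
      -- minimality over the class `𝒫_d` of rank-`d` orthogonal projections
      ∀ P : H →L[ℝ] H, IsSelfAdjoint P → IsIdempotentElem P →
        Module.finrank ℝ (LinearMap.range (P : H →ₗ[ℝ] H)) = d →
        (∑' j : ℕ, ⟪u (j + 1),
            Sig (u (j + 1) - (∑ l ∈ Finset.range d,
              rankOne (u (l + 1)) (u (l + 1))) (u (j + 1)))⟫) ≤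
          ∑' j : ℕ, ⟪u (j + 1), Sig (u (j + 1) - P (u (j + 1)))⟫ := by
  intro d hd
  have hub : ∀ j, u (j + 1) = b j := fun j => (hb j).symm
  simp only [hub] at hSig ⊢
  have hμ : Antitone fun j => lam (j + 1) :=
    antitone_nat_of_succ_le fun j => hmono (j + 1) (by omega)
  have hterm : ∀ (Q : H →L[ℝ] H) (j : ℕ),
      ⟪b j, Sig (b j - Q (b j))⟫ = lam (j + 1) * (1 - ⟪b j, Q (b j)⟫) := fun Q j => by
    rw [hSig, b.orthonormal.inner_tsum_smul_rankOne_apply hsum, inner_sub_right,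
      real_inner_self_eq_norm_sq, b.orthonormal.1 j, one_pow]
  simp only [hterm, b.orthonormal.inner_sum_rankOne_apply_self]
  refine ⟨?_, fun P hP hPi hrank => ?_⟩
  · have hs : Summable fun j => lam (j + 1) * (1 - if j < d then 1 else 0) :=
      hsum.norm.of_norm_bounded fun j => by split_ifs <;> simp
    rw [← hs.sum_add_tsum_nat_add d, Finset.sum_eq_zero, zero_add]
    · refine tsum_congr fun k => ?_
      rw [if_neg (by omega), sub_zero, mul_one]
      congr 1
      omega
    · intro j hj
      rw [if_pos (Finset.mem_range.1 hj), sub_self, mul_zero]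
  · have : FiniteDimensional ℝ (LinearMap.range (P : H →ₗ[ℝ] H)) :=
      Module.finite_of_finrank_pos (by omega)
    refine tsum_tail_le_tsum_mul_one_sub hμ hsum (fun j => ?_) (fun j => ?_)
      (hrank ▸ b.hasSum_inner_apply_self hP hPi)
    · rw [inner_self_apply_eq_norm_sq hP hPi]
      positivity
    · rw [inner_self_apply_eq_norm_sq hP hPi]
      refine pow_le_one₀ (norm_nonneg _) ?_
      simpa [b.orthonormal.1 j] using
        norm_apply_le_of_isSelfAdjoint_of_isIdempotentElem hP hPi (b j)
end

section
/- Let α > 0, β ∈ (0,1], and K > 0, and suppose (λ_j)_{j≥1} satisfies K^{-1} exp(−α j^β) ≤ λ_j ≤ K exp(−α j^β) for all j ≥ 1. Then there exists a constant C > 1 depending only on α, β, and K such that for all natural numbers d ≥ 1: C^{-1} (d+1)^{1−β} exp(−α(d+1)^β) ≤ Σ_{k>d} λ_k ≤ C d^{1−β} exp(−α d^β). -/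
open Real Filter Topology

/-- Tangent line bound for the concave power `x ↦ x ^ p`. -/
theorem add_rpow_le_rpow_add_mul {x s p : ℝ} (hx : 0 < x) (hs : -x ≤ s) (hp : 0 ≤ p)
    (hp1 : p ≤ 1) : (x + s) ^ p ≤ x ^ p + p * s * x ^ (p - 1) := by
  have hsx : -1 ≤ s / x := by rw [le_div_iff₀ hx]; linarith
  have h := rpow_one_add_le_one_add_mul_self hsx hp hp1
  have hfac : x + s = x * (1 + s / x) := by field_simp
  rw [hfac, mul_rpow hx.le (by linarith), rpow_sub_one hx.ne']
  calc x ^ p * (1 + s / x) ^ p ≤ x ^ p * (1 + p * (s / x)) := by gcongr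
    _ = x ^ p + p * s * (x ^ p / x) := by ring

theorem exp_neg_mul_rpow_sub_le {α β x : ℝ} (hα : 0 < α) (hβ : 0 < β) (hβ1 : β ≤ 1)
    (hx : 0 < x) :
    x ^ (1 - β) * exp (-α * x ^ β) - (x + 1) ^ (1 - β) * exp (-α * (x + 1) ^ β) ≤
      α * β * exp (-α * x ^ β) := by
  have hpow : x ^ (1 - β) ≤ (x + 1) ^ (1 - β) :=
    rpow_le_rpow hx.le (by linarith) (by linarith)
  have htan := add_rpow_le_rpow_add_mul hx (s := 1) (by linarith) hβ.le hβ1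
  have hexp : exp (-α * x ^ β) * (1 - α * ((x + 1) ^ β - x ^ β)) ≤
      exp (-α * (x + 1) ^ β) := by
    have hsplit : exp (-α * (x + 1) ^ β) =
        exp (-α * x ^ β) * exp (-(α * ((x + 1) ^ β - x ^ β))) := by
      rw [← exp_add]; ring_nf
    rw [hsplit]
    gcongr
    linarith [add_one_le_exp (-(α * ((x + 1) ^ β - x ^ β)))]
  have hcancel : x ^ (1 - β) * x ^ (β - 1) = 1 := by
    rw [← rpow_add hx]; simp
  have hpos : 0 ≤ x ^ (1 - β) := by positivity
  have hlow : x ^ (1 - β) * (exp (-α * x ^ β) * (1 - α * (β * x ^ (β - 1)))) ≤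
      (x + 1) ^ (1 - β) * exp (-α * (x + 1) ^ β) := by
    calc _ ≤ x ^ (1 - β) * (exp (-α * x ^ β) * (1 - α * ((x + 1) ^ β - x ^ β))) := by
          gcongr; linarith
      _ ≤ x ^ (1 - β) * exp (-α * (x + 1) ^ β) := by gcongr
      _ ≤ _ := by gcongr
  linear_combination hlow + α * β * exp (-α * x ^ β) * hcancel

theorem exp_neg_mul_rpow_le_sub {α β A x : ℝ} (hα : 0 < α) (hβ : 0 < β) (hβ1 : β ≤ 1)
    (hA : 1 ≤ A) (hAβ : A ^ (-β) ≤ α * β / 2) (hx : 0 < x) :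
    α * β / 2 * exp (-α * (x + 1) ^ β) ≤
      (x + A) ^ (1 - β) * exp (-α * x ^ β) -
        (x + 1 + A) ^ (1 - β) * exp (-α * (x + 1) ^ β) := by
  have hx1 : 0 < x + 1 := by linarith
  have hxA : 0 < x + A := by linarith
  have hpow : (x + 1 + A) ^ (1 - β) ≤ (x + A) ^ (1 - β) + α * β / 2 := by
    have h := add_rpow_le_rpow_add_mul hxA (s := 1) (p := 1 - β) (by linarith)
      (by linarith) (by linarith)
    have hneg : (x + A) ^ (-β) ≤ A ^ (-β) :=
      rpow_le_rpow_of_nonpos (by linarith) (by linarith) (by linarith)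
    have hnn : 0 ≤ (x + A) ^ (-β) := by positivity
    have he : 1 - β - 1 = -β := by ring
    have hadd : x + A + 1 = x + 1 + A := by ring
    rw [he, hadd] at h
    nlinarith
  have htan := add_rpow_le_rpow_add_mul hx1 (s := -1) (by linarith) hβ.le hβ1
  rw [add_neg_cancel_right] at htan
  have hexp : exp (-α * (x + 1) ^ β) * (1 + α * ((x + 1) ^ β - x ^ β)) ≤
      exp (-α * x ^ β) := by
    have hsplit : exp (-α * x ^ β) =
        exp (-α * (x + 1) ^ β) * exp (α * ((x + 1) ^ β - x ^ β)) := by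
      rw [← exp_add]; ring_nf
    rw [hsplit]
    gcongr
    linarith [add_one_le_exp (α * ((x + 1) ^ β - x ^ β))]
  have hratio : 1 ≤ (x + A) ^ (1 - β) * (x + 1) ^ (β - 1) := by
    calc (1 : ℝ) = (x + 1) ^ (1 - β) * (x + 1) ^ (β - 1) := by
          rw [← rpow_add hx1]; simp
      _ ≤ _ := by gcongr
  set e := exp (-α * (x + 1) ^ β)
  have he : 0 < e := exp_pos _
  have hlow : (x + A) ^ (1 - β) * (e * (1 + α * (β * (x + 1) ^ (β - 1)))) ≤
      (x + A) ^ (1 - β) * exp (-α * x ^ β) := by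
    calc _ ≤ (x + A) ^ (1 - β) * (e * (1 + α * ((x + 1) ^ β - x ^ β))) := by
          gcongr; linarith
      _ ≤ _ := by gcongr
  have hup := mul_le_mul_of_nonneg_right hpow he.le
  have hmid := mul_le_mul_of_nonneg_left hratio (by positivity : 0 ≤ α * β * e)
  linear_combination hlow + hup + hmid

theorem tendsto_rpow_mul_exp_neg_mul_rpow {α β : ℝ} (hα : 0 < α) (hβ : 0 < β) (s : ℝ) :
    Tendsto (fun x : ℝ => x ^ s * exp (-α * x ^ β)) atTop (𝓝 0) := by
  refine ((tendsto_rpow_mul_exp_neg_mul_atTop_nhds_zero (s / β) α hα).comp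
    (tendsto_rpow_atTop hβ)).congr' ?_
  filter_upwards [eventually_ge_atTop 0] with x hx
  simp only [Function.comp_apply]
  rw [← rpow_mul hx, mul_div_cancel₀ _ hβ.ne']

theorem sum_exp_neg_mul_rpow_le {α β A : ℝ} (hα : 0 < α) (hβ : 0 < β) (hβ1 : β ≤ 1)
    (hA : 1 ≤ A) (hAβ : A ^ (-β) ≤ α * β / 2) {d : ℕ} (hd : 1 ≤ d) (n : ℕ) :
    ∑ k ∈ Finset.range n, exp (-α * ((d + 1 + k : ℕ) : ℝ) ^ β) ≤
      2 / (α * β) * (1 + A) ^ (1 - β) * ((d : ℝ) ^ (1 - β) * exp (-α * (d : ℝ) ^ β)) := by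
  have hd1 : (1 : ℝ) ≤ d := by exact_mod_cast hd
  let g : ℕ → ℝ := fun k => ((d + k : ℝ) + A) ^ (1 - β) * exp (-α * (d + k : ℝ) ^ β)
  have hstep (k : ℕ) : α * β / 2 * exp (-α * ((d + 1 + k : ℕ) : ℝ) ^ β) ≤
      g k - g (k + 1) := by
    have h := exp_neg_mul_rpow_le_sub hα hβ hβ1 hA hAβ
      (x := (d + k : ℝ)) (by positivity)
    have hcast : ((d + 1 + k : ℕ) : ℝ) = d + k + 1 := by push_cast; ring
    simp only [g, hcast, Nat.cast_add, Nat.cast_one, ← add_assoc]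
    exact h
  have hsum := Finset.sum_le_sum fun k (_ : k ∈ Finset.range n) => hstep k
  rw [← Finset.mul_sum, Finset.sum_range_sub'] at hsum
  have hgn : 0 ≤ g n := by simp only [g]; positivity
  have hg0 : g 0 ≤ (1 + A) ^ (1 - β) * (d : ℝ) ^ (1 - β) * exp (-α * (d : ℝ) ^ β) := by
    simp only [g, Nat.cast_zero, add_zero]
    rw [← mul_rpow (by linarith) (by linarith)]
    gcongr
    nlinarith
  have hαβ : 0 < α * β := by positivity
  calc _ = 2 / (α * β) * (α * β / 2 *
        ∑ k ∈ Finset.range n, exp (-α * ((d + 1 + k : ℕ) : ℝ) ^ β)) := by field_simp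
    _ ≤ 2 / (α * β) *
        ((1 + A) ^ (1 - β) * (d : ℝ) ^ (1 - β) * exp (-α * (d : ℝ) ^ β)) := by
      exact mul_le_mul_of_nonneg_left (by linarith) (by positivity)
    _ = _ := by ring

theorem rpow_mul_exp_neg_mul_rpow_le_tsum {α β : ℝ} (hα : 0 < α) (hβ : 0 < β)
    (hβ1 : β ≤ 1) {m : ℕ} (hm : 1 ≤ m)
    (hsum : Summable fun k : ℕ => exp (-α * ((m + k : ℕ) : ℝ) ^ β)) :
    (m : ℝ) ^ (1 - β) * exp (-α * (m : ℝ) ^ β) ≤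
      α * β * ∑' k : ℕ, exp (-α * ((m + k : ℕ) : ℝ) ^ β) := by
  let f : ℕ → ℝ := fun k =>
    ((m + k : ℕ) : ℝ) ^ (1 - β) * exp (-α * ((m + k : ℕ) : ℝ) ^ β)
  have hf : Tendsto f atTop (𝓝 0) :=
    (tendsto_rpow_mul_exp_neg_mul_rpow hα hβ (1 - β)).comp
      (tendsto_natCast_atTop_atTop.comp (tendsto_atTop_mono (fun k => Nat.le_add_left k m)
        tendsto_id))
  have hlim : Tendsto (fun n => f 0 - f n) atTop (𝓝 (f 0)) := by
    simpa using hf.const_sub (f 0)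
  have hle : f 0 ≤ α * β * ∑' k : ℕ, exp (-α * ((m + k : ℕ) : ℝ) ^ β) := by
    refine le_of_tendsto' hlim fun n => ?_
    rw [← Finset.sum_range_sub']
    calc _ ≤ ∑ k ∈ Finset.range n, α * β * exp (-α * ((m + k : ℕ) : ℝ) ^ β) := by
          refine Finset.sum_le_sum fun k _ => ?_
          have hpos : (0 : ℝ) < ((m + k : ℕ) : ℝ) := by exact_mod_cast (by omega)
          have h := exp_neg_mul_rpow_sub_le hα hβ hβ1 hpos
          simpa only [f, ← add_assoc, Nat.cast_add, Nat.cast_one] using h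
      _ ≤ _ := by
          rw [← Finset.mul_sum]
          gcongr
          exact hsum.sum_le_tsum _ fun k _ => (exp_pos _).le
  simpa [f] using hle

/-- **Tail sum bounds for nearly exponentially decaying eigenvalues** (equation (10)):
if `K⁻¹ exp(-α j^β) ≤ λ_j ≤ K exp(-α j^β)` for all `j ≥ 1`, then there is a constant
`C > 1`, depending only on `α`, `β` and `K`, with
`C⁻¹ (d+1)^{1-β} exp(-α (d+1)^β) ≤ ∑_{k > d} λ_k ≤ C d^{1-β} exp(-α d^β)`
for all `d ≥ 1`. -/
theorem tail_sum_nearly_exponential_decay :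
    ∀ α β K : ℝ, 0 < α → 0 < β → β ≤ 1 → 0 < K →
    ∃ C : ℝ, 1 < C ∧
    ∀ lam : ℕ → ℝ,
      (∀ j : ℕ, 1 ≤ j → 0 < lam j) →
      (∀ j : ℕ, 1 ≤ j → K⁻¹ * Real.exp (-α * (j : ℝ) ^ β) ≤ lam j ∧
        lam j ≤ K * Real.exp (-α * (j : ℝ) ^ β)) →
      ∀ d : ℕ, 1 ≤ d →
        C⁻¹ * ((d : ℝ) + 1) ^ (1 - β) * Real.exp (-α * ((d : ℝ) + 1) ^ β) ≤
          (∑' k : ℕ, lam (d + 1 + k)) ∧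
        (∑' k : ℕ, lam (d + 1 + k)) ≤
          C * (d : ℝ) ^ (1 - β) * Real.exp (-α * (d : ℝ) ^ β) := by
  intro α β K hα hβ hβ1 hK
  set A : ℝ := 1 + (2 / (α * β)) ^ (1 / β) with hAdef
  have hαβ : 0 < α * β := mul_pos hα hβ
  have hA : 1 ≤ A := by rw [hAdef]; linarith [rpow_nonneg (div_pos two_pos hαβ).le (1 / β)]
  have hAβ : A ^ (-β) ≤ α * β / 2 := by
    calc A ^ (-β) ≤ ((2 / (α * β)) ^ (1 / β)) ^ (-β) :=
          rpow_le_rpow_of_nonpos (by positivity) (by linarith) (by linarith)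
      _ = α * β / 2 := by
          rw [← rpow_mul (by positivity), mul_neg, one_div_mul_cancel hβ.ne', rpow_neg_one,
            inv_div]
  set U : ℝ := 2 / (α * β) * (1 + A) ^ (1 - β) with hU
  have hU0 : 0 < U := by positivity
  have hKU : 0 < K * U := mul_pos hK hU0
  have hL : 0 < α * β * K := mul_pos hαβ hK
  refine ⟨1 + K * U + α * β * K, by linarith, fun lam hpos hlam d hd => ?_⟩
  have hbound := sum_exp_neg_mul_rpow_le hα hβ hβ1 hA hAβ hd
  have hE : Summable fun k : ℕ => exp (-α * ((d + 1 + k : ℕ) : ℝ) ^ β) :=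
    summable_of_sum_range_le (fun k => (exp_pos _).le) hbound
  have hlamsum : Summable fun k => lam (d + 1 + k) :=
    .of_nonneg_of_le (fun k => (hpos _ (by omega)).le) (fun k => (hlam _ (by omega)).2)
      (hE.mul_left K)
  constructor
  · have h := rpow_mul_exp_neg_mul_rpow_le_tsum hα hβ hβ1 (m := d + 1) (by omega) hE
    have hle : ∑' k : ℕ, exp (-α * ((d + 1 + k : ℕ) : ℝ) ^ β) ≤
        K * ∑' k : ℕ, lam (d + 1 + k) := by
      rw [← tsum_mul_left]
      refine hE.tsum_le_tsum (fun k => ?_) (hlamsum.mul_left K)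
      rw [← inv_mul_le_iff₀ hK]
      exact (hlam _ (by omega)).1
    have hS : 0 ≤ ∑' k : ℕ, lam (d + 1 + k) :=
      tsum_nonneg fun k => (hpos _ (by omega)).le
    rw [mul_assoc, inv_mul_le_iff₀ (by linarith)]
    push_cast at h
    calc _ ≤ α * β * (K * ∑' k : ℕ, lam (d + 1 + k)) := by
          refine h.trans ?_
          push_cast at hle
          gcongr
      _ = α * β * K * ∑' k : ℕ, lam (d + 1 + k) := by ring
      _ ≤ _ := by gcongr; linarith
  · calc ∑' k : ℕ, lam (d + 1 + k)
        ≤ ∑' k : ℕ, K * exp (-α * ((d + 1 + k : ℕ) : ℝ) ^ β) :=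
          hlamsum.tsum_le_tsum (fun k => (hlam _ (by omega)).2) (hE.mul_left K)
      _ = K * ∑' k : ℕ, exp (-α * ((d + 1 + k : ℕ) : ℝ) ^ β) := tsum_mul_left
      _ ≤ K * (U * ((d : ℝ) ^ (1 - β) * exp (-α * (d : ℝ) ^ β))) := by
          gcongr
          exact Real.tsum_le_of_sum_range_le (fun k => (exp_pos _).le) hbound
      _ = K * U * (d : ℝ) ^ (1 - β) * exp (-α * (d : ℝ) ^ β) := by ring
      _ ≤ _ := by gcongr; linarith
end

section
/- For every β ∈ (0,1] and every x ∈ [0, 1/2], one has βx ≤ 1 − (1 − x)^β ≤ 2^{1−β} βx. -/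
/-- **A concavity estimate**: for every `β ∈ (0,1]` and every `x ∈ [0, 1/2]`,
`β x ≤ 1 - (1 - x)^β ≤ 2^{1-β} β x`. -/
theorem one_sub_rpow_bounds :
    ∀ β x : ℝ, 0 < β → β ≤ 1 → 0 ≤ x → x ≤ 1 / 2 →
      β * x ≤ 1 - (1 - x) ^ β ∧ 1 - (1 - x) ^ β ≤ 2 ^ (1 - β) * (β * x) := by
  intro β x hβ hβ1 hx hx2
  have hy : 0 < 1 - x := by linarith
  constructor
  · have h := rpow_one_add_le_one_add_mul_self (s := -x) (by linarith) hβ.le hβ1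
    rw [← sub_eq_add_neg] at h
    linarith
  · have hs : 0 ≤ x / (1 - x) := by positivity
    -- Bernoulli's inequality for `(1 - x)⁻¹ = 1 + x / (1 - x)`
    have h := rpow_one_add_le_one_add_mul_self (s := x / (1 - x)) (by linarith) hβ.le hβ1
    have hinv : 1 + x / (1 - x) = (1 - x)⁻¹ := by field_simp; ring
    rw [hinv, Real.inv_rpow hy.le] at h
    have hpos : 0 < (1 - x) ^ β := Real.rpow_pos_of_pos hy β
    have hmul := mul_le_mul_of_nonneg_left h hpos.le
    rw [mul_inv_cancel₀ hpos.ne'] at hmul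
    have hpow : (1 - x) ^ β / (1 - x) ≤ 2 ^ (1 - β) := by
      rw [← Real.rpow_sub_one hy.ne', ← neg_sub 1 β, Real.rpow_neg hy.le,
        ← Real.inv_rpow hy.le]
      refine Real.rpow_le_rpow (by positivity) ?_ (by linarith)
      rw [inv_le_comm₀ hy two_pos]
      linarith
    have hfin := mul_le_mul_of_nonneg_right hpow (mul_nonneg hβ.le hx)
    have heq : (1 - x) ^ β * (1 + β * (x / (1 - x)))
        = (1 - x) ^ β + (1 - x) ^ β / (1 - x) * (β * x) := by ring
    linarith
end

section
/- Let α > 0, β ∈ (0,1], K > 0, and suppose (λ_j)_{j≥1} satisfies K^{-1} exp(−α j^β) ≤ λ_j ≤ K exp(−α j^β) for all j ≥ 1. Then for all natural numbers d ≥ 1 and k with 1 ≤ k ≤ (d+1)/2, setting d′ = d + 1 − k, one has K^{-2} exp(αβ (d+1)^{β−1} k) ≤ λ_{d′}/λ_{d+1} ≤ K² exp(2^{1−β} αβ (d+1)^{β−1} k). -/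
/-- The graph of `x ↦ x ^ p`, `0 ≤ p ≤ 1`, lies below its tangent lines. -/
theorem Real.rpow_le_rpow_add_tangent {p x y : ℝ} (hp0 : 0 ≤ p) (hp1 : p ≤ 1)
    (hx : 0 < x) (hy : 0 ≤ y) :
    y ^ p ≤ x ^ p + p * x ^ (p - 1) * (y - x) := by
  have hs : -1 ≤ y / x - 1 := by
    have := div_nonneg hy hx.le
    linarith
  have h := rpow_one_add_le_one_add_mul_self hs hp0 hp1
  rw [add_sub_cancel, Real.div_rpow hy hx.le, div_le_iff₀ (Real.rpow_pos_of_pos hx p)] at h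
  refine h.trans (le_of_eq ?_)
  rw [Real.rpow_sub_one hx.ne']
  field_simp

/-- Two-sided mean value bound for the increment of `x ↦ x ^ p` from `m` to `n`, when
`n / 2 ≤ m ≤ n`. -/
theorem Real.rpow_sub_rpow_bounds {p m n : ℝ} (hp0 : 0 ≤ p) (hp1 : p ≤ 1) (hn : 0 < n)
    (hm : n / 2 ≤ m) (hmn : m ≤ n) :
    p * n ^ (p - 1) * (n - m) ≤ n ^ p - m ^ p ∧
      n ^ p - m ^ p ≤ 2 ^ (1 - p) * p * n ^ (p - 1) * (n - m) := by
  have hm0 : 0 < m := by linarith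
  constructor
  · linarith [Real.rpow_le_rpow_add_tangent hp0 hp1 hn hm0.le]
  · have h1 : m ^ (p - 1) ≤ 2 ^ (1 - p) * n ^ (p - 1) := by
      refine (Real.rpow_le_rpow_of_nonpos (by positivity) hm (by linarith)).trans (le_of_eq ?_)
      rw [Real.div_rpow hn.le zero_le_two, ← neg_sub 1 p, Real.rpow_neg zero_le_two, div_inv_eq_mul,
        mul_comm]
    have h2 := mul_le_mul_of_nonneg_left h1 (mul_nonneg hp0 (sub_nonneg.2 hmn))
    linarith [Real.rpow_le_rpow_add_tangent hp0 hp1 hm0 hn.le]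

/-- **Eigenvalue ratio bounds for nearly exponential decay** (equation (11)):
if `K⁻¹ exp(-α j^β) ≤ λ_j ≤ K exp(-α j^β)` for all `j ≥ 1`, then for all `d ≥ 1` and
`1 ≤ k ≤ (d+1)/2`, setting `d' = d + 1 - k`,
`K⁻² exp(αβ (d+1)^{β-1} k) ≤ λ_{d'}/λ_{d+1} ≤ K² exp(2^{1-β} αβ (d+1)^{β-1} k)`. -/
theorem eigenvalue_ratio_nearly_exponential_decay
    (α β K : ℝ) (hα : 0 < α) (hβ : 0 < β) (hβ1 : β ≤ 1) (hK : 0 < K)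
    (lam : ℕ → ℝ)
    (hpos : ∀ j : ℕ, 1 ≤ j → 0 < lam j)
    (hbound : ∀ j : ℕ, 1 ≤ j → K⁻¹ * Real.exp (-α * (j : ℝ) ^ β) ≤ lam j ∧
      lam j ≤ K * Real.exp (-α * (j : ℝ) ^ β)) :
    ∀ d k : ℕ, 1 ≤ d → 1 ≤ k → (k : ℝ) ≤ ((d : ℝ) + 1) / 2 →
      K⁻¹ ^ 2 * Real.exp (α * β * ((d : ℝ) + 1) ^ (β - 1) * k) ≤
        lam (d + 1 - k) / lam (d + 1) ∧
      lam (d + 1 - k) / lam (d + 1) ≤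
        K ^ 2 * Real.exp (2 ^ (1 - β) * α * β * ((d : ℝ) + 1) ^ (β - 1) * k) := by
  intro d k hd hk hkd
  have hk' : k ≤ d := by
    have h2 : 2 * k ≤ d + 1 := by
      have : (2 * k : ℝ) ≤ d + 1 := by linarith
      exact_mod_cast this
    omega
  have hcast : ((d + 1 - k : ℕ) : ℝ) = (d : ℝ) + 1 - k := by
    rw [Nat.cast_sub (by omega)]
    push_cast
    ring
  obtain ⟨hl1, hu1⟩ := hbound (d + 1 - k) (by omega)
  obtain ⟨hl2, hu2⟩ := hbound (d + 1) (by omega)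
  have hp := hpos (d + 1) (by omega)
  rw [hcast] at hl1 hu1
  push_cast at hl2 hu2
  obtain ⟨hlow, hupp⟩ := Real.rpow_sub_rpow_bounds (p := β) (m := (d : ℝ) + 1 - k)
    (n := (d : ℝ) + 1) hβ.le hβ1 (by positivity) (by linarith)
    (by linarith [Nat.cast_nonneg (α := ℝ) k])
  rw [sub_sub_cancel] at hlow hupp
  have hlow' := mul_le_mul_of_nonneg_left hlow hα.le
  have hupp' := mul_le_mul_of_nonneg_left hupp hα.le
  constructor
  · rw [le_div_iff₀ hp]
    calc _ ≤ K⁻¹ ^ 2 * Real.exp (α * β * ((d : ℝ) + 1) ^ (β - 1) * k) *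
          (K * Real.exp (-α * ((d : ℝ) + 1) ^ β)) := by gcongr
      _ = K⁻¹ * Real.exp (α * β * ((d : ℝ) + 1) ^ (β - 1) * k + -α * ((d : ℝ) + 1) ^ β) := by
        rw [Real.exp_add]
        field_simp
      _ ≤ K⁻¹ * Real.exp (-α * ((d : ℝ) + 1 - k) ^ β) := by
        gcongr
        linarith
      _ ≤ _ := hl1
  · rw [div_le_iff₀ hp]
    calc _ ≤ K * Real.exp (-α * ((d : ℝ) + 1 - k) ^ β) := hu1
      _ ≤ K * Real.exp (2 ^ (1 - β) * α * β * ((d : ℝ) + 1) ^ (β - 1) * k +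
          -α * ((d : ℝ) + 1) ^ β) := by
        gcongr
        linarith
      _ = K ^ 2 * Real.exp (2 ^ (1 - β) * α * β * ((d : ℝ) + 1) ^ (β - 1) * k) *
          (K⁻¹ * Real.exp (-α * ((d : ℝ) + 1) ^ β)) := by
        rw [Real.exp_add]
        field_simp
      _ ≤ _ := by gcongr
end
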